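/- Let μ be a Borel probability measure on a compact interval 𝕀 ⊂ ℝ of positive length, and n ∈ ℕ. There exists a best Kolmogorov-distance approximation of μ among probability measures supported on at most n points, and its distance to μ equals K_•^{•,n} = min{ a ≥ 0 : S_{F_μ,a}^{[n]}(0) ≥ 1 }. Moreover, for every x ∈ Ξ_n and p ∈ Π_n the following are equivalent: (i) d_K(μ, δ_x^p) = min_{y∈Ξ_n, q∈Π_n} d_K(μ, δ_y^q); (ii) for every j = 0,…,n with x_j < x_{j+1}: F_{μ−}(x_{j+1}) − K_•^{•,n} ≤ P_j ≤ F_μ(x_j) + K_•^{•,n}; (iii) for every j = 1,…,n with P_{j−1} < P_j: F⁻¹_{μ−}(P_j − K_•^{•,n}) ≤ x_j ≤ F_μ⁻¹(P_{j−1} + K_•^{•,n}). -/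

import Mathlib

open MeasureTheory Filter Set

noncomputable section

namespace BenfordApprox

/-- Right-hand limit `f₊` of a nondecreasing `f : ℝ → ℝ̄`, at an extended-real point. -/
def fplus (f : ℝ → EReal) (a : EReal) : EReal := sInf (f '' {x : ℝ | a < (x : EReal)})

/-- Left-hand limit `f₋` of a nondecreasing `f : ℝ → ℝ̄`, at an extended-real point. -/
def fminus (f : ℝ → EReal) (a : EReal) : EReal := sSup (f '' {x : ℝ | (x : EReal) < a})

/-- The (upper) inverse function `f⁻¹(t) = sup {x : f x ≤ t}` (with `sup ∅ = ⊥`). -/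
def upperInv (f : ℝ → EReal) (t : ℝ) : EReal :=
  sSup ((fun x : ℝ => (x : EReal)) '' {x : ℝ | f x ≤ (t : EReal)})

/-- The upper inverse, for an extended-real argument. -/
def upperInvE (f : ℝ → EReal) (t : EReal) : EReal :=
  sSup ((fun x : ℝ => (x : EReal)) '' {x : ℝ | f x ≤ t})

/-- Lévy-type distance `d_L(f,g)` between nondecreasing functions `f g : ℝ → ℝ̄`. -/
def dLfun (f g : ℝ → EReal) : EReal :=
  sInf ((fun y : ℝ => (y : EReal)) ''
    {y : ℝ | 0 ≤ y ∧ ∀ x : ℝ, f (x - y) - (y : EReal) ≤ g x ∧ g x ≤ f (x + y) + (y : EReal)})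

/-- The auxiliary function `ℓ_{f,I}`; it depends on `I` only through `lo = inf I`, `hi = sup I`. -/
def ell (f : ℝ → EReal) (lo hi : EReal) (x : ℝ) : ℝ :=
  sInf {y : ℝ | 0 ≤ y ∧ fminus f (hi - (y : EReal)) - (y : EReal) ≤ (x : EReal) ∧
    (x : EReal) ≤ fplus f (lo + (y : EReal)) + (y : EReal)}

/-- The minimal value `ℓ*_{f,I} = min {y ≥ 0 : f₋(sup I − y) − y ≤ f₊(inf I + y) + y}`. -/
def ellStar (f : ℝ → EReal) (lo hi : EReal) : ℝ :=
  sInf {y : ℝ | 0 ≤ y ∧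
    fminus f (hi - (y : EReal)) - (y : EReal) ≤ fplus f (lo + (y : EReal)) + (y : EReal)}

/-- Distribution function `F_μ(t) = μ {y ∈ 𝕀 : y ≤ t}` of `μ`, where `𝕀 = [A,B]`. -/
def cdf (μ : Measure ℝ) (A B : ℝ) (t : ℝ) : ℝ := (μ (Icc A B ∩ Iic t)).toReal

/-- `F_μ` evaluated at an extended-real point (so `F_μ(−∞) = 0`, `F_μ(+∞) = 1`). -/
def cdfE (μ : Measure ℝ) (A B : ℝ) (a : EReal) : ℝ :=
  (μ (Icc A B ∩ {y : ℝ | (y : EReal) ≤ a})).toReal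

/-- Left limit `F_{μ−}` at an extended-real point (so `F_{μ−}(−∞) = 0`, `F_{μ−}(+∞) = 1`). -/
def cdfL (μ : Measure ℝ) (A B : ℝ) (a : EReal) : ℝ :=
  sSup ((cdf μ A B) '' {t : ℝ | (t : EReal) < a})

/-- Left limit `F_{μ−}` at a real point. -/
def cdfm (μ : Measure ℝ) (A B : ℝ) (t : ℝ) : ℝ := sSup ((cdf μ A B) '' Iio t)

/-- The (upper) quantile function `F_μ⁻¹` of `μ` on `𝕀 = [A,B]`, extended monotonically to `ℝ`. -/
def quant (μ : Measure ℝ) (A B : ℝ) (t : ℝ) : ℝ :=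
  if t < (μ {A}).toReal ∨ t < 0 then A
  else sSup {y ∈ Icc A B | cdf μ A B y ≤ t}

/-- Left limit `F⁻¹_{μ−}` of the quantile function. -/
def quantm (μ : Measure ℝ) (A B : ℝ) (t : ℝ) : ℝ := sSup ((quant μ A B) '' Iio t)

/-- `F_μ` as a function into the extended reals. -/
def cdfEReal (μ : Measure ℝ) (A B : ℝ) : ℝ → EReal := fun t => ((cdf μ A B t : ℝ) : EReal)

/-- `F_μ⁻¹` as a function into the extended reals. -/
def quantEReal (μ : Measure ℝ) (A B : ℝ) : ℝ → EReal := fun t => ((quant μ A B t : ℝ) : EReal)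

/-- The finitely supported measure `δ_x^p = Σ_j p_j δ_{x_j}`. -/
def discr (n : ℕ) (x p : Fin n → ℝ) : Measure ℝ :=
  ∑ j : Fin n, ENNReal.ofReal (p j) • Measure.dirac (x j)

/-- `p ∈ Π_n`: a probability vector. -/
def IsPi (n : ℕ) (p : Fin n → ℝ) : Prop := (∀ j, 0 ≤ p j) ∧ ∑ j, p j = 1

/-- `x ∈ Ξ_n`: a nondecreasing vector of locations in `𝕀 = [A,B]`. -/
def IsXi (A B : ℝ) (n : ℕ) (x : Fin n → ℝ) : Prop := (∀ j, x j ∈ Icc A B) ∧ Monotone x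

/-- The uniform weight vector `u_n = (1/n, …, 1/n)`. -/
def unif (n : ℕ) : Fin n → ℝ := fun _ => 1 / (n : ℝ)

/-- Partial sums `P_i = Σ_{j<i} p_j` (so `P_0 = 0`, `P_n = 1`). -/
def psum (n : ℕ) (p : Fin n → ℝ) (i : ℕ) : ℝ := ∑ j : Fin n, if (j : ℕ) < i then p j else 0

/-- Locations extended by `x_0 = −∞`, `x_{n+1} = +∞`; here `extPts n x j` is the paper's `x_j`. -/
def extPts (n : ℕ) (x : Fin n → ℝ) : ℕ → EReal := fun j =>
  if hj : j = 0 then ⊥ else if h : j ≤ n then ((x ⟨j - 1, by omega⟩ : ℝ) : EReal) else ⊤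

/-- `xcoord n x j` is the paper's `x_{j+1}` (0-based access). -/
def xcoord (n : ℕ) (x : Fin n → ℝ) (j : ℕ) : ℝ := if h : j < n then x ⟨j, h⟩ else 0

/-- The normalizing constant `ω = max{1, λ(𝕀)}/λ(𝕀)` for `𝕀 = [A,B]`. -/
def omegaI (A B : ℝ) : ℝ := max 1 (B - A) / (B - A)

/-- Lévy distance between Borel measures on `𝕀 = [A,B]`. -/
def dLevy (A B : ℝ) (μ ν : Measure ℝ) : ℝ :=
  omegaI A B * sInf {y : ℝ | 0 ≤ y ∧
    ∀ t : ℝ, cdf μ A B (t - y) - y ≤ cdf ν A B t ∧ cdf ν A B t ≤ cdf μ A B (t + y) + y}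

/-- Kolmogorov (uniform) distance between Borel measures on `𝕀 = [A,B]`. -/
def dKol (A B : ℝ) (μ ν : Measure ℝ) : ℝ :=
  sSup (Set.range fun t : ℝ => |cdf μ A B t - cdf ν A B t|)

/-- `L¹`-Kantorovich distance between Borel measures on `𝕀 = [A,B]`. -/
def dKant1 (A B : ℝ) (μ ν : Measure ℝ) : ℝ :=
  (B - A)⁻¹ * ∫ y in Ioo (0 : ℝ) 1, |quant μ A B y - quant ν A B y|

/-- `L^r`-Kantorovich distance between Borel measures on `𝕀 = [A,B]`. -/
def dKant (A B r : ℝ) (μ ν : Measure ℝ) : ℝ :=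
  (B - A)⁻¹ * (∫ y in Ioo (0 : ℝ) 1, |quant μ A B y - quant ν A B y| ^ r) ^ (1 / r)

/-- The Benford measure `β_b` on `[1,b]`: the law of `b^U` with `U` uniform on `[0,1)`. -/
def benford (b : ℝ) : Measure ℝ := (volume.restrict (Ico (0 : ℝ) 1)).map (fun t : ℝ => b ^ t)

/-- The map `T_{f,a}(x) = f₊(f⁻¹(x+a) + 2a) + a`. -/
def Tmap (f : ℝ → EReal) (a : ℝ) : EReal → EReal :=
  fun x => fplus f (upperInvE f (x + (a : EReal)) + ((2 * a : ℝ) : EReal)) + (a : EReal)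

/-- The map `S_{f,a}(x) = f₊(f⁻¹(x+a)) + a`. -/
def Smap (f : ℝ → EReal) (a : ℝ) : EReal → EReal :=
  fun x => fplus f (upperInvE f (x + (a : EReal))) + (a : EReal)

/-- `L_•^{•,n} = min {a ≥ 0 : T_{F_μ,a}^{[n]}(0) ≥ 1}`. -/
def LBB (μ : Measure ℝ) (A B : ℝ) (n : ℕ) : ℝ :=
  sInf {a : ℝ | 0 ≤ a ∧ (1 : EReal) ≤ (Tmap (cdfEReal μ A B) a)^[n] ((0 : ℝ) : EReal)}

/-- `K_•^{•,n} = min {a ≥ 0 : S_{F_μ,a}^{[n]}(0) ≥ 1}`. -/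
def KBB (μ : Measure ℝ) (A B : ℝ) (n : ℕ) : ℝ :=
  sInf {a : ℝ | 0 ≤ a ∧ (1 : EReal) ≤ (Smap (cdfEReal μ A B) a)^[n] ((0 : ℝ) : EReal)}

/-! ### The distribution function -/

theorem cdf_mono (μ : Measure ℝ) [IsFiniteMeasure μ] (A B : ℝ) : Monotone (cdf μ A B) := by
  intro s t hst
  exact ENNReal.toReal_mono (measure_ne_top _ _)
    (measure_mono (inter_subset_inter_right _ (Iic_subset_Iic.2 hst)))

theorem cdf_nonneg (μ : Measure ℝ) (A B t : ℝ) : 0 ≤ cdf μ A B t := ENNReal.toReal_nonneg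

theorem cdf_of_lt (μ : Measure ℝ) {A B t : ℝ} (ht : t < A) : cdf μ A B t = 0 := by
  have h : Icc A B ∩ Iic t = ∅ := by
    ext y
    simp only [mem_inter_iff, mem_Icc, mem_Iic, mem_empty_iff_false, iff_false]
    rintro ⟨⟨h1, -⟩, h2⟩
    linarith
  simp [cdf, h]

theorem cdf_of_ge {μ : Measure ℝ} {A B t : ℝ} (hμ : μ (Icc A B) = 1) (ht : B ≤ t) :
    cdf μ A B t = 1 := by
  have h : Icc A B ∩ Iic t = Icc A B :=
    inter_eq_left.2 fun y hy => hy.2.trans ht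
  simp [cdf, h, hμ]

theorem cdf_le_one (μ : Measure ℝ) [IsProbabilityMeasure μ] (A B t : ℝ) : cdf μ A B t ≤ 1 :=
  ENNReal.toReal_le_of_le_ofReal zero_le_one (by simpa using prob_le_one)

theorem cdf_left_endpoint (μ : Measure ℝ) {A B : ℝ} (hAB : A < B) :
    cdf μ A B A = (μ {A}).toReal := by
  have h : Icc A B ∩ Iic A = {A} := by
    ext y
    simp only [mem_inter_iff, mem_Icc, mem_Iic, mem_singleton_iff]
    constructor
    · rintro ⟨⟨h1, -⟩, h2⟩
      linarith
    · rintro rfl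
      exact ⟨⟨le_rfl, hAB.le⟩, le_rfl⟩
  rw [cdf, h]

/-- Right-continuity of the distribution function. -/
theorem exists_gt_cdf_lt (μ : Measure ℝ) [IsFiniteMeasure μ] (A B : ℝ) {t s : ℝ}
    (h : cdf μ A B t < s) : ∃ u, t < u ∧ cdf μ A B u < s := by
  have hlim : Tendsto (fun k : ℕ => μ (Icc A B ∩ Iic (t + 1 / ((k : ℝ) + 1)))) atTop
      (nhds (μ (⋂ k : ℕ, Icc A B ∩ Iic (t + 1 / ((k : ℝ) + 1))))) := by
    refine tendsto_measure_iInter_atTop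
      (fun k => (measurableSet_Icc.inter measurableSet_Iic).nullMeasurableSet) ?_
      ⟨0, measure_ne_top _ _⟩
    intro i j hij
    refine inter_subset_inter_right _ (Iic_subset_Iic.2 ?_)
    have := Nat.one_div_le_one_div (α := ℝ) hij
    linarith
  have hI : (⋂ k : ℕ, Icc A B ∩ Iic (t + 1 / ((k : ℝ) + 1))) = Icc A B ∩ Iic t := by
    ext y
    simp only [mem_iInter, mem_inter_iff, mem_Iic]
    constructor
    · intro hy
      refine ⟨(hy 0).1, le_of_forall_pos_lt_add fun ε hε => ?_⟩
      obtain ⟨k, hk⟩ := exists_nat_one_div_lt hε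
      linarith [(hy k).2]
    · rintro ⟨h1, h2⟩ k
      exact ⟨h1, h2.trans (by linarith [Nat.one_div_pos_of_nat (α := ℝ) (n := k)])⟩
  rw [hI] at hlim
  have hlim' := (ENNReal.tendsto_toReal (measure_ne_top μ _)).comp hlim
  obtain ⟨k, hk⟩ := (hlim'.eventually (gt_mem_nhds h)).exists
  exact ⟨t + 1 / ((k : ℝ) + 1), by linarith [Nat.one_div_pos_of_nat (α := ℝ) (n := k)], hk⟩

/-! ### The quantile function -/

section Quantile

variable {A B : ℝ} {μ : Measure ℝ}

theorem quant_mem_Icc (hAB : A < B) (s : ℝ) : quant μ A B s ∈ Icc A B := by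
  unfold quant
  split_ifs with h
  · exact ⟨le_rfl, hAB.le⟩
  · rw [not_or, not_lt, not_lt] at h
    have hA : A ∈ {y ∈ Icc A B | cdf μ A B y ≤ s} :=
      ⟨⟨le_rfl, hAB.le⟩, (cdf_left_endpoint μ hAB).trans_le h.1⟩
    exact ⟨le_csSup ⟨B, fun y hy => hy.1.2⟩ hA, csSup_le ⟨A, hA⟩ fun y hy => hy.1.2⟩

theorem le_quant [IsFiniteMeasure μ] (hAB : A < B) {s t : ℝ} (hs : cdf μ A B t ≤ s)
    (ht : t ≤ B) : t ≤ quant μ A B s := by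
  rcases lt_or_ge t A with htA | htA
  · exact htA.le.trans (quant_mem_Icc hAB s).1
  have h : ¬ (s < (μ {A}).toReal ∨ s < 0) := by
    rw [not_or, not_lt, not_lt, ← cdf_left_endpoint μ hAB]
    exact ⟨(cdf_mono μ A B htA).trans hs, (cdf_nonneg μ A B t).trans hs⟩
  rw [quant, if_neg h]
  exact le_csSup ⟨B, fun y hy => hy.1.2⟩ ⟨⟨htA, ht⟩, hs⟩

theorem cdf_le_of_lt_quant [IsFiniteMeasure μ] (hAB : A < B) {s t : ℝ} (hA : A ≤ t)
    (ht : t < quant μ A B s) : cdf μ A B t ≤ s := by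
  unfold quant at ht
  split_ifs at ht with h
  · linarith
  · rw [not_or, not_lt, not_lt] at h
    have hA : A ∈ {y ∈ Icc A B | cdf μ A B y ≤ s} :=
      ⟨⟨le_rfl, hAB.le⟩, (cdf_left_endpoint μ hAB).trans_le h.1⟩
    obtain ⟨y, hy, hty⟩ := exists_lt_of_lt_csSup ⟨A, hA⟩ ht
    exact (cdf_mono μ A B hty.le).trans hy.2

theorem quant_le [IsFiniteMeasure μ] (hAB : A < B) {s t : ℝ} (hA : A ≤ t)
    (hs : s < cdf μ A B t) : quant μ A B s ≤ t :=
  not_lt.1 fun h => hs.not_ge (cdf_le_of_lt_quant hAB hA h)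

theorem quant_mono [IsFiniteMeasure μ] (hAB : A < B) : Monotone (quant μ A B) := by
  intro s s' hs
  by_contra! h
  obtain ⟨t, h1, h2⟩ := exists_between h
  have := le_quant hAB ((cdf_le_of_lt_quant hAB ((quant_mem_Icc hAB s').1.trans h1.le) h2).trans hs)
    (h2.le.trans (quant_mem_Icc hAB s).2)
  linarith

theorem le_cdf_quant [IsFiniteMeasure μ] (hAB : A < B) (hμ : μ (Icc A B) = 1) {s : ℝ}
    (hs : s ≤ 1) : s ≤ cdf μ A B (quant μ A B s) := by
  by_contra! h
  obtain ⟨u, hu, hus⟩ := exists_gt_cdf_lt μ A B h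
  have huB : u < B := by
    by_contra! hB
    rw [cdf_of_ge hμ hB] at hus
    linarith
  exact hu.not_ge (le_quant hAB hus.le huB.le)

theorem lt_cdf_of_quant_lt [IsFiniteMeasure μ] (hAB : A < B) (hμ : μ (Icc A B) = 1) {s t : ℝ}
    (hs : s < 1) (ht : quant μ A B s < t) : s < cdf μ A B t := by
  by_contra! h
  have htB : t < B := by
    by_contra! hB
    rw [cdf_of_ge hμ hB] at h
    linarith
  exact ht.not_ge (le_quant hAB h htB.le)

end Quantile

/-! ### Iterates of `Smap` -/

/-- A `k`-step chain for the function `F` with gap `a` ending strictly below `v`: points `y₁, …, y_k`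
with `0 < F y₁ - a`, `F y_i + a < F y_{i+1} - a` and `F y_k + a < v`. -/
def HasChain (F : ℝ → ℝ) (a : ℝ) : ℕ → ℝ → Prop
  | 0, v => 0 < v
  | k + 1, v => ∃ y, HasChain F a k (F y - a) ∧ F y + a < v

theorem Smap_lt_iff {F : ℝ → ℝ} (hF : Monotone F)
    (hr : ∀ t s, F t < s → ∃ u, t < u ∧ F u < s) (a : ℝ) (u : EReal) (v : ℝ) :
    Smap (fun t => (F t : EReal)) a u < v ↔ ∃ y, u < (F y - a : ℝ) ∧ F y + a < v := by
  have key : ∀ y : ℝ, u < (F y - a : ℝ) ↔ u + (a : EReal) < F y := by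
    intro y
    induction u with
    | bot => simp [-EReal.coe_sub]
    | top => simp [-EReal.coe_sub]
    | coe u =>
      rw [← EReal.coe_add, EReal.coe_lt_coe_iff, EReal.coe_lt_coe_iff]
      exact lt_sub_iff_add_lt
  have hlt : ∀ w : EReal, w + (a : EReal) < v ↔ w < ((v - a : ℝ) : EReal) := by
    intro w
    induction w with
    | bot => simp [-EReal.coe_sub]
    | top => simp [-EReal.coe_sub]
    | coe w =>
      rw [← EReal.coe_add, EReal.coe_lt_coe_iff, EReal.coe_lt_coe_iff]
      exact lt_sub_iff_add_lt.symm
  simp only [key]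
  rw [Smap, hlt, fplus, sInf_lt_iff]
  constructor
  · rintro ⟨_, ⟨y, hy, rfl⟩, hyv⟩
    refine ⟨y, ?_, by linarith [EReal.coe_lt_coe_iff.1 hyv]⟩
    by_contra! h
    have hle : (y : EReal) ≤ upperInvE (fun t => (F t : EReal)) (u + a) := le_sSup ⟨y, h, rfl⟩
    exact hle.not_gt hy
  · rintro ⟨y, hy, hyv⟩
    obtain ⟨z, hz, hzv⟩ := hr y (v - a) (by linarith)
    refine ⟨_, ⟨z, ?_, rfl⟩, EReal.coe_lt_coe_iff.2 hzv⟩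
    refine lt_of_le_of_lt (sSup_le ?_) (EReal.coe_lt_coe_iff.2 hz)
    rintro _ ⟨x, hx, rfl⟩
    by_contra! h
    have hyx : y ≤ x := (EReal.coe_lt_coe_iff.1 h).le
    exact (hy.trans_le (EReal.coe_le_coe_iff.2 (hF hyx))).not_ge hx

theorem Smap_iterate_lt_iff {F : ℝ → ℝ} (hF : Monotone F)
    (hr : ∀ t s, F t < s → ∃ u, t < u ∧ F u < s) (a : ℝ) (k : ℕ) (v : ℝ) :
    (Smap (fun t => (F t : EReal)) a)^[k] ((0 : ℝ) : EReal) < v ↔ HasChain F a k v := by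
  induction k generalizing v with
  | zero => simp [HasChain]
  | succ k ih =>
    rw [Function.iterate_succ_apply', Smap_lt_iff hF hr]
    simp only [HasChain, ih]

theorem HasChain.mono {F : ℝ → ℝ} {a : ℝ} {k : ℕ} {v w : ℝ} (h : HasChain F a k v)
    (hvw : v ≤ w) : HasChain F a k w := by
  cases k with
  | zero => exact lt_of_lt_of_le (show (0 : ℝ) < v from h) hvw
  | succ k =>
    obtain ⟨y, hy, hyv⟩ := h
    exact ⟨y, hy, hyv.trans_le hvw⟩

/-- Having a chain is an open condition on the gap. -/
theorem HasChain.eventually {F : ℝ → ℝ} {a : ℝ} {k : ℕ} {v : ℝ} (h : HasChain F a k v) :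
    ∃ w < v, ∀ᶠ b in nhds a, HasChain F b k w := by
  induction k generalizing v with
  | zero =>
    obtain ⟨w, h0, hw⟩ := exists_between (show (0 : ℝ) < v from h)
    exact ⟨w, hw, Eventually.of_forall fun _ => h0⟩
  | succ k ih =>
    obtain ⟨y, hy, hyv⟩ := h
    obtain ⟨w, hw, hev⟩ := ih hy
    obtain ⟨v', h1, h2⟩ := exists_between hyv
    refine ⟨v', h2, ?_⟩
    have e1 : ∀ᶠ b in nhds a, b < F y - w := gt_mem_nhds (by linarith)
    have e2 : ∀ᶠ b in nhds a, b < v' - F y := gt_mem_nhds (by linarith)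
    filter_upwards [hev, e1, e2] with b hb h1 h2
    exact ⟨y, hb.mono (by linarith), by linarith⟩

theorem KBB_spec (A B : ℝ) (μ : Measure ℝ) [IsProbabilityMeasure μ] {n : ℕ} (hn : 0 < n) :
    0 ≤ KBB μ A B n ∧ ¬ HasChain (cdf μ A B) (KBB μ A B n) n 1 ∧
      ∀ a, 0 ≤ a → ¬ HasChain (cdf μ A B) a n 1 → KBB μ A B n ≤ a := by
  have hset : {a : ℝ | 0 ≤ a ∧ (1 : EReal) ≤ (Smap (cdfEReal μ A B) a)^[n] ((0 : ℝ) : EReal)} =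
      {a : ℝ | 0 ≤ a ∧ ¬ HasChain (cdf μ A B) a n 1} := by
    ext a
    rw [mem_ofPred_eq, mem_ofPred_eq,
      ← Smap_iterate_lt_iff (cdf_mono μ A B) (fun t s => exists_gt_cdf_lt μ A B), not_lt]
    rfl
  have hclosed : IsClosed {a : ℝ | 0 ≤ a ∧ ¬ HasChain (cdf μ A B) a n 1} := by
    refine isClosed_Ici.inter (isOpen_compl_iff.1 (isOpen_iff_mem_nhds.2 fun a ha => ?_))
    obtain ⟨w, hw, hev⟩ := (not_not.1 ha : HasChain (cdf μ A B) a n 1).eventually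
    filter_upwards [hev] with b hb
    exact not_not.2 (hb.mono hw.le)
  have hbdd : BddBelow {a : ℝ | 0 ≤ a ∧ ¬ HasChain (cdf μ A B) a n 1} := ⟨0, fun a ha => ha.1⟩
  have hne : {a : ℝ | 0 ≤ a ∧ ¬ HasChain (cdf μ A B) a n 1}.Nonempty := by
    refine ⟨1, zero_le_one, ?_⟩
    obtain ⟨k, rfl⟩ := Nat.exists_eq_add_one.2 hn
    rintro ⟨y, -, hy⟩
    linarith [cdf_nonneg μ A B y]
  have hmem := hclosed.csInf_mem hne hbdd
  rw [KBB, hset]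
  exact ⟨hmem.1, hmem.2, fun a h0 ha => csInf_le hbdd ⟨h0, ha⟩⟩

/-! ### Finitely supported measures -/

theorem cdf_discr {A B : ℝ} {n : ℕ} {x p : Fin n → ℝ} (hx : IsXi A B n x) (hp : IsPi n p) (t : ℝ) :
    cdf (discr n x p) A B t = ∑ j, if x j ≤ t then p j else 0 := by
  rw [cdf, discr, Measure.finsetSum_apply, ENNReal.toReal_sum]
  · refine Finset.sum_congr rfl fun j _ => ?_
    rw [Measure.smul_apply, Measure.dirac_apply' _ (measurableSet_Icc.inter measurableSet_Iic)]
    by_cases h : x j ≤ t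
    · simp [h, (hx.1 j).1, (hx.1 j).2, hp.1 j]
    · simp [h]
  · intro j _
    rw [Measure.smul_apply]
    exact ENNReal.mul_ne_top ENNReal.ofReal_ne_top (measure_ne_top _ _)

theorem psum_mono {n : ℕ} {p : Fin n → ℝ} (hp : IsPi n p) : Monotone (psum n p) := by
  intro i k hik
  refine Finset.sum_le_sum fun j _ => ?_
  split_ifs with h1 h2
  · exact le_rfl
  · omega
  · exact hp.1 j
  · exact le_rfl

theorem psum_zero (n : ℕ) (p : Fin n → ℝ) : psum n p 0 = 0 := by simp [psum]

theorem psum_self {n : ℕ} {p : Fin n → ℝ} (hp : IsPi n p) : psum n p n = 1 := by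
  rw [← hp.2]
  exact Finset.sum_congr rfl fun j _ => if_pos j.2

theorem psum_of_differences {n : ℕ} (P : ℕ → ℝ) (h0 : P 0 = 0) {i : ℕ} (hi : i ≤ n) :
    psum n (fun j : Fin n => P (j + 1) - P j) i = P i := by
  unfold psum
  rw [Fin.sum_univ_eq_sum_range (fun j : ℕ => if j < i then P (j + 1) - P j else 0) n,
    ← Finset.sum_filter]
  have : (Finset.range n).filter (fun j => j < i) = Finset.range i := by
    ext j
    simp only [Finset.mem_filter, Finset.mem_range]
    omega
  rw [this, Finset.sum_range_sub, h0, sub_zero]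

/-- The points `≤ t` of a nondecreasing vector are the first `k` ones, for some `k`. -/
theorem exists_count {n : ℕ} {x : Fin n → ℝ} (hx : Monotone x) (t : ℝ) :
    ∃ k ≤ n, ∀ j : Fin n, x j ≤ t ↔ (j : ℕ) < k := by
  induction n with
  | zero => exact ⟨0, le_rfl, fun j => j.elim0⟩
  | succ n ih =>
    by_cases hl : x (Fin.last n) ≤ t
    · exact ⟨n + 1, le_rfl, fun j => ⟨fun _ => j.2, fun _ => (hx (Fin.le_last j)).trans hl⟩⟩
    · obtain ⟨k, hk, h⟩ := ih (x := fun j => x j.castSucc) fun i j hij => hx (by simpa using hij)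
      refine ⟨k, hk.trans n.le_succ, fun j => ?_⟩
      refine Fin.lastCases ?_ (fun i => ?_) j
      · simp only [hl, false_iff, Fin.val_last]
        omega
      · simpa using h i

theorem sum_ite_eq_psum {n k : ℕ} {x p : Fin n → ℝ} {t : ℝ}
    (h : ∀ j : Fin n, x j ≤ t ↔ (j : ℕ) < k) :
    (∑ j, if x j ≤ t then p j else 0) = psum n p k := by
  simp only [psum, h]

/-- A distribution function with at most `n` jumps cannot follow a long chain. -/
theorem card_of_hasChain {F : ℝ → ℝ} {n : ℕ} {x p : Fin n → ℝ} (hp : ∀ j, 0 ≤ p j) {a : ℝ}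
    (hd : ∀ t, |F t - ∑ j, if x j ≤ t then p j else 0| ≤ a) {k : ℕ} {v t : ℝ}
    (hc : HasChain F a k v) (hv : v ≤ ∑ j, if x j ≤ t then p j else 0) :
    k + 1 ≤ (Finset.univ.filter fun j => x j ≤ t).card := by
  induction k generalizing v t with
  | zero =>
    have hpos : 0 < ∑ j, if x j ≤ t then p j else 0 := lt_of_lt_of_le hc hv
    rw [← Finset.sum_filter] at hpos
    have := Finset.nonempty_of_sum_ne_zero hpos.ne'
    simpa only [zero_add] using Nat.succ_le_of_lt this.card_pos
  | succ k ih =>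
    obtain ⟨y, hy, hyv⟩ := hc
    have hdy := abs_le.1 (hd y)
    have h1 := ih hy (t := y) (by linarith)
    refine h1.trans_lt (Finset.card_lt_card ?_)
    have hlt : (∑ j, if x j ≤ y then p j else 0) < ∑ j, if x j ≤ t then p j else 0 := by linarith
    have hyt : y ≤ t := by
      by_contra! h
      refine hlt.not_ge (Finset.sum_le_sum fun j _ => ?_)
      split_ifs with h1 h2
      · exact le_rfl
      · exact absurd (h1.trans h.le) h2
      · exact hp j
      · exact le_rfl
    refine Finset.ssubset_iff_subset_ne.2 ⟨fun j hj => ?_, fun he => ?_⟩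
    · simp only [Finset.mem_filter, Finset.mem_univ, true_and] at hj ⊢
      exact hj.trans hyt
    · rw [← Finset.sum_filter, ← Finset.sum_filter, he] at hlt
      exact lt_irrefl _ hlt

section Distance

variable {A B : ℝ} {μ : Measure ℝ} [IsProbabilityMeasure μ] {n : ℕ} {x p : Fin n → ℝ}

theorem sum_ite_mem_Icc (hp : IsPi n p) (t : ℝ) :
    (∑ j, if x j ≤ t then p j else 0) ∈ Icc (0 : ℝ) 1 := by
  rw [← hp.2, ← Finset.sum_filter]
  exact ⟨Finset.sum_nonneg fun j _ => hp.1 j,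
    Finset.sum_le_sum_of_subset_of_nonneg (Finset.filter_subset _ _) fun j _ _ => hp.1 j⟩

theorem dKol_discr_le_iff (hx : IsXi A B n x) (hp : IsPi n p) (a : ℝ) :
    dKol A B μ (discr n x p) ≤ a ↔
      ∀ t, |cdf μ A B t - ∑ j, if x j ≤ t then p j else 0| ≤ a := by
  have hb : BddAbove (Set.range fun t : ℝ => |cdf μ A B t - cdf (discr n x p) A B t|) := by
    refine ⟨1, ?_⟩
    rintro _ ⟨t, rfl⟩
    have h1 := sum_ite_mem_Icc (x := x) hp t
    rw [← cdf_discr hx hp] at h1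
    exact abs_le.2 ⟨by linarith [h1.2, cdf_nonneg μ A B t], by linarith [h1.1, cdf_le_one μ A B t]⟩
  rw [dKol, csSup_le_iff hb (range_nonempty _), forall_mem_range]
  simp only [cdf_discr hx hp]

theorem KBB_le_dKol_discr (hn : 0 < n) (hx : IsXi A B n x) (hp : IsPi n p) :
    KBB μ A B n ≤ dKol A B μ (discr n x p) := by
  have hd := (dKol_discr_le_iff (μ := μ) hx hp _).1 le_rfl
  refine (KBB_spec A B μ hn).2.2 _ ((abs_nonneg _).trans (hd 0)) fun hc => ?_
  have := card_of_hasChain hp.1 hd hc (t := B) (by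
    rw [← hp.2]
    exact (Finset.sum_congr rfl fun j _ => (if_pos (hx.1 j).2).symm).le)
  have h2 := Finset.card_le_univ (Finset.univ.filter fun j => x j ≤ B)
  rw [Fintype.card_fin] at h2
  omega

/-! ### Characterizations of the distance -/

theorem extPts_zero : extPts n x 0 = ⊥ := by simp [extPts]

theorem extPts_succ {j : ℕ} (hj : j < n) : extPts n x (j + 1) = (x ⟨j, hj⟩ : EReal) := by
  simp [extPts, Nat.succ_le_of_lt hj]

theorem extPts_succ_self : extPts n x (n + 1) = ⊤ := by simp [extPts]

/-- `t` lies in the `k`-th interval between consecutive points iff exactly the first `k` points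
are `≤ t`. -/
theorem extPts_le_lt_iff (hx : Monotone x) {k : ℕ} (hk : k ≤ n) (t : ℝ) :
    (extPts n x k ≤ t ∧ (t : EReal) < extPts n x (k + 1)) ↔
      ∀ j : Fin n, x j ≤ t ↔ (j : ℕ) < k := by
  constructor
  · rintro ⟨h1, h2⟩ j
    constructor
    · intro hj
      by_contra! hkj
      rw [extPts_succ (hkj.trans_lt j.2), EReal.coe_lt_coe_iff] at h2
      exact (h2.trans_le (hx (show (⟨k, hkj.trans_lt j.2⟩ : Fin n) ≤ j from hkj))).not_ge hj
    · intro hj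
      obtain ⟨i, rfl⟩ := Nat.exists_eq_add_one.2 (Nat.zero_lt_of_lt hj)
      rw [extPts_succ hk, EReal.coe_le_coe_iff] at h1
      exact (hx (show j ≤ ⟨i, hk⟩ from Nat.le_of_lt_succ hj)).trans h1
  · intro h
    constructor
    · cases k with
      | zero => simp [extPts_zero]
      | succ i =>
        rw [extPts_succ hk, EReal.coe_le_coe_iff]
        exact (h ⟨i, hk⟩).2 (Nat.lt_succ_self i)
    · rcases hk.lt_or_eq with hk | rfl
      · rw [extPts_succ hk, EReal.coe_lt_coe_iff]
        by_contra! hc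
        exact lt_irrefl _ ((h ⟨k, hk⟩).1 hc)
      · rw [extPts_succ_self]
        exact EReal.coe_lt_top t

theorem forall_abs_le_iff_weights (hx : IsXi A B n x) {a : ℝ} (ha : 0 ≤ a) :
    (∀ t, |cdf μ A B t - ∑ j, if x j ≤ t then p j else 0| ≤ a) ↔
      ∀ j : ℕ, j ≤ n → extPts n x j < extPts n x (j + 1) →
        cdfL μ A B (extPts n x (j + 1)) - a ≤ psum n p j ∧
          psum n p j ≤ cdfE μ A B (extPts n x j) + a := by
  constructor
  · intro h j hj hlt
    obtain ⟨r, hr1, hr2⟩ := EReal.lt_iff_exists_real_btwn.1 hlt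
    constructor
    · rw [sub_le_iff_le_add]
      refine csSup_le ⟨_, r, hr2, rfl⟩ ?_
      rintro _ ⟨t, ht, rfl⟩
      have hm : extPts n x j ≤ (max t r : ℝ) ∧ ((max t r : ℝ) : EReal) < extPts n x (j + 1) :=
        ⟨hr1.le.trans (EReal.coe_le_coe_iff.2 (le_max_right _ _)), by
          rcases max_choice t r with h | h <;> rw [h] <;> assumption⟩
      have hd := h (max t r)
      rw [sum_ite_eq_psum ((extPts_le_lt_iff hx.2 hj _).1 hm)] at hd
      linarith [cdf_mono μ A B (le_max_left t r), (abs_le.1 hd).2]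
    · cases j with
      | zero =>
        rw [psum_zero]
        exact add_nonneg ENNReal.toReal_nonneg ha
      | succ i =>
        rw [extPts_succ hj] at hlt ⊢
        have hd := h (x ⟨i, hj⟩)
        rw [sum_ite_eq_psum ((extPts_le_lt_iff hx.2 hj _).1
          ⟨(extPts_succ hj).le, hlt⟩)] at hd
        have he : cdfE μ A B (x ⟨i, hj⟩ : EReal) = cdf μ A B (x ⟨i, hj⟩) := by
          simp only [cdfE, cdf, EReal.coe_le_coe_iff]
          rfl
        rw [he]
        linarith [(abs_le.1 hd).1]
  · intro h t
    obtain ⟨k, hk, hkt⟩ := exists_count hx.2 t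
    have hkt' := (extPts_le_lt_iff hx.2 hk t).2 hkt
    obtain ⟨h1, h2⟩ := h k hk (hkt'.1.trans_lt hkt'.2)
    rw [sum_ite_eq_psum hkt]
    have e1 : cdf μ A B t ≤ cdfL μ A B (extPts n x (k + 1)) := by
      refine le_csSup ⟨1, ?_⟩ ⟨t, hkt'.2, rfl⟩
      rintro _ ⟨s, -, rfl⟩
      exact cdf_le_one μ A B s
    have e2 : cdfE μ A B (extPts n x k) ≤ cdf μ A B t :=
      ENNReal.toReal_mono (measure_ne_top _ _) (measure_mono (inter_subset_inter_right _
        fun y hy => EReal.coe_le_coe_iff.1 (le_trans hy hkt'.1)))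
    exact abs_le.2 ⟨by linarith, by linarith⟩

theorem forall_abs_le_iff_locations (hAB : A < B) (hμ : μ (Icc A B) = 1) (hx : IsXi A B n x)
    (hp : IsPi n p) {a : ℝ} (ha : 0 ≤ a) :
    (∀ t, |cdf μ A B t - ∑ j, if x j ≤ t then p j else 0| ≤ a) ↔
      ∀ j : Fin n, psum n p (j : ℕ) < psum n p ((j : ℕ) + 1) →
        quantm μ A B (psum n p ((j : ℕ) + 1) - a) ≤ x j ∧
          x j ≤ quant μ A B (psum n p (j : ℕ) + a) := by
  constructor
  · intro h j hj
    constructor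
    · refine csSup_le (nonempty_Iio.image _) ?_
      rintro _ ⟨s, hs, rfl⟩
      refine quant_le hAB (hx.1 j).1 ?_
      obtain ⟨k, hk, hkt⟩ := exists_count hx.2 (x j)
      have hd := h (x j)
      rw [sum_ite_eq_psum hkt] at hd
      have := psum_mono hp (show (j : ℕ) + 1 ≤ k from (hkt j).1 le_rfl)
      linarith [(abs_le.1 hd).1, mem_Iio.1 hs]
    · refine le_of_forall_lt fun t ht => ?_
      obtain ⟨u, htu, hux⟩ := exists_between ht
      refine htu.trans_le (le_quant hAB ?_ (hux.le.trans (hx.1 j).2))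
      obtain ⟨k, hk, hkt⟩ := exists_count hx.2 u
      have hd := h u
      rw [sum_ite_eq_psum hkt] at hd
      have := psum_mono hp (show k ≤ (j : ℕ) from not_lt.1 fun hc => hux.not_ge ((hkt j).2 hc))
      linarith [(abs_le.1 hd).2]
  · intro h t
    obtain ⟨k, hk, hkt⟩ := exists_count hx.2 t
    rw [sum_ite_eq_psum hkt]
    have hP0 : 0 ≤ psum n p k := by rw [← psum_zero n p]; exact psum_mono hp k.zero_le
    have hP1 : psum n p k ≤ 1 := by rw [← psum_self hp]; exact psum_mono hp hk
    refine abs_le.2 ⟨?_, ?_⟩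
    · rcases hP0.eq_or_lt with h0 | h0
      · linarith [cdf_nonneg μ A B t]
      have hex : ∃ i, psum n p k ≤ psum n p i := ⟨k, le_rfl⟩
      classical
      let i := Nat.find hex
      have hi : psum n p k ≤ psum n p i := Nat.find_spec hex
      have hik : i ≤ k := Nat.find_min' hex le_rfl
      have hi0 : i ≠ 0 := by
        intro hc
        rw [hc, psum_zero] at hi
        linarith
      obtain ⟨m, hm⟩ := Nat.exists_eq_add_one_of_ne_zero hi0
      have hmlt : psum n p m < psum n p k := not_le.1 (Nat.find_min hex (by omega))
      rw [hm] at hi hik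
      have hmn : m < n := by omega
      obtain ⟨hq, -⟩ := h ⟨m, hmn⟩ (hmlt.trans_le hi)
      have hxt : x ⟨m, hmn⟩ ≤ t := (hkt _).2 hik
      by_contra! hc
      obtain ⟨s, hs1, hs2⟩ := exists_between
        (show cdf μ A B t < psum n p (m + 1) - a by linarith)
      obtain ⟨u, htu, hus⟩ := exists_gt_cdf_lt μ A B hs1
      have huB : u ≤ B := by
        by_contra! hB
        rw [cdf_of_ge hμ hB.le] at hus
        have := psum_mono hp (show m + 1 ≤ n from hmn)
        rw [psum_self hp] at this
        linarith
      have h1 : quant μ A B s ≤ quantm μ A B (psum n p (m + 1) - a) := by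
        refine le_csSup ⟨B, ?_⟩ ⟨s, hs2, rfl⟩
        rintro _ ⟨r, -, rfl⟩
        exact (quant_mem_Icc hAB r).2
      have h2 := le_quant hAB hus.le huB
      have hq' : quantm μ A B (psum n p (m + 1) - a) ≤ x ⟨m, hmn⟩ := hq
      linarith
    · rcases hP1.eq_or_lt with h1 | h1
      · linarith [cdf_le_one μ A B t]
      have hex : ∃ i, psum n p k < psum n p i := ⟨n, by rwa [psum_self hp]⟩
      classical
      let i := Nat.find hex
      have hi : psum n p k < psum n p i := Nat.find_spec hex
      have hin : i ≤ n := Nat.find_min' hex (by rwa [psum_self hp])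
      have hki : k < i := not_le.1 fun hc => hi.not_ge (psum_mono hp hc)
      obtain ⟨m, hm⟩ := Nat.exists_eq_add_one_of_ne_zero (Nat.ne_zero_of_lt hki)
      have hmle : psum n p m ≤ psum n p k := not_lt.1 (Nat.find_min hex (by omega))
      rw [hm] at hi hin hki
      obtain ⟨-, hq⟩ := h ⟨m, hin⟩ (hmle.trans_lt hi)
      have hxt : t < x ⟨m, hin⟩ := not_le.1 fun hc => by
        have := (hkt _).1 hc
        simp only at this
        omega
      rcases lt_or_ge t A with htA | htA
      · rw [cdf_of_lt μ htA]
        linarith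
      · have := cdf_le_of_lt_quant hAB htA (hxt.trans_le hq)
        simp only at this
        linarith

end Distance

/-! ### The greedy construction -/

/-- Cumulative weights of the greedy approximation at distance `a`. -/
def greedy (μ : Measure ℝ) (A B a : ℝ) : ℕ → ℝ
  | 0 => 0
  | k + 1 => min 1 (cdf μ A B (quant μ A B (greedy μ A B a k + a)) + a)

section Greedy

variable {A B : ℝ} {μ : Measure ℝ} {a : ℝ}

theorem greedy_le_one (k : ℕ) : greedy μ A B a k ≤ 1 := by
  cases k with
  | zero => exact zero_le_one
  | succ k => exact min_le_left _ _

variable [IsProbabilityMeasure μ]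

theorem le_greedy_succ (hAB : A < B) (hμ : μ (Icc A B) = 1) (ha : 0 ≤ a) (k : ℕ) :
    greedy μ A B a k ≤ greedy μ A B a (k + 1) := by
  refine le_min (greedy_le_one k) ?_
  rcases le_or_gt (greedy μ A B a k + a) 1 with h | h
  · linarith [le_cdf_quant hAB hμ h]
  · have h1 := le_cdf_quant hAB hμ (le_refl (1 : ℝ))
    have h2 := cdf_mono μ A B (quant_mono (μ := μ) hAB h.le)
    linarith [greedy_le_one (A := A) (B := B) (μ := μ) (a := a) k]

theorem hasChain_of_greedy_lt (hAB : A < B) (hμ : μ (Icc A B) = 1) (ha : 0 ≤ a) {k : ℕ} {v : ℝ}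
    (hv : v ≤ 1) (h : greedy μ A B a k < v) : HasChain (cdf μ A B) a k v := by
  induction k generalizing v with
  | zero => exact h
  | succ k ih =>
    have hlt : cdf μ A B (quant μ A B (greedy μ A B a k + a)) + a < v :=
      (min_lt_iff.1 h).resolve_left hv.not_gt
    have hs : greedy μ A B a k + a < 1 := by
      by_contra! hc
      have h1 := le_cdf_quant hAB hμ (le_refl (1 : ℝ))
      have h2 := cdf_mono μ A B (quant_mono (μ := μ) hAB hc)
      linarith
    obtain ⟨y, hy, hyv⟩ := exists_gt_cdf_lt μ A B (lt_sub_iff_add_lt.2 hlt)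
    have := lt_cdf_of_quant_lt hAB hμ hs hy
    exact ⟨y, ih (by linarith [cdf_le_one μ A B y]) (by linarith), by linarith⟩

theorem exists_dKol_discr_le (hAB : A < B) (hμ : μ (Icc A B) = 1) (ha : 0 ≤ a) {n : ℕ}
    (hc : ¬ HasChain (cdf μ A B) a n 1) :
    ∃ x p : Fin n → ℝ, IsXi A B n x ∧ IsPi n p ∧ dKol A B μ (discr n x p) ≤ a := by
  let P := greedy μ A B a
  have hPmono : Monotone P := monotone_nat_of_le_succ (le_greedy_succ hAB hμ ha)
  have hPn : P n = 1 := (greedy_le_one n).antisymm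
    (not_lt.1 fun h => hc (hasChain_of_greedy_lt hAB hμ ha le_rfl h))
  let p : Fin n → ℝ := fun j => P (j + 1) - P j
  let x : Fin n → ℝ := fun j => quant μ A B (P j + a)
  have hps : ∀ i ≤ n, psum n p i = P i := fun i hi => psum_of_differences P rfl hi
  have hx : IsXi A B n x := ⟨fun j => quant_mem_Icc hAB _, fun i j hij =>
    quant_mono hAB (add_le_add_left (hPmono (Fin.le_def.1 hij)) a)⟩
  have hp : IsPi n p := by
    refine ⟨fun j => sub_nonneg.2 (hPmono (Nat.le_succ _)), ?_⟩
    rw [← hPn, ← hps n le_rfl]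
    exact Finset.sum_congr rfl fun j _ => (if_pos j.2).symm
  refine ⟨x, p, hx, hp, (dKol_discr_le_iff hx hp a).2
    ((forall_abs_le_iff_locations hAB hμ hx hp ha).2 fun j _ => ?_)⟩
  rw [hps _ j.2, hps _ j.2.le]
  refine ⟨csSup_le (nonempty_Iio.image _) ?_, le_rfl⟩
  rintro _ ⟨s, hs, rfl⟩
  refine quant_le hAB (hx.1 j).1 ?_
  have h1 : P (j + 1) ≤ cdf μ A B (x j) + a := min_le_right _ _
  linarith [mem_Iio.1 hs]

end Greedy

/-- Thm. 5.6: existence and characterization of best (unconstrained)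
Kolmogorov-distance approximations of `μ` by measures with at most `n` atoms. -/
theorem best_dKol (A B : ℝ) (hAB : A < B) (μ : Measure ℝ) [IsProbabilityMeasure μ]
    (hμ : μ (Icc A B) = 1) (n : ℕ) (hn : 0 < n) :
    (∃ x p : Fin n → ℝ, IsXi A B n x ∧ IsPi n p ∧
      (∀ y q : Fin n → ℝ, IsXi A B n y → IsPi n q →
        dKol A B μ (discr n x p) ≤ dKol A B μ (discr n y q)) ∧
      dKol A B μ (discr n x p) = KBB μ A B n) ∧
    ∀ x p : Fin n → ℝ, IsXi A B n x → IsPi n p →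
      (((∀ y q : Fin n → ℝ, IsXi A B n y → IsPi n q →
          dKol A B μ (discr n x p) ≤ dKol A B μ (discr n y q)) ↔
        (∀ j : ℕ, j ≤ n → extPts n x j < extPts n x (j + 1) →
          cdfL μ A B (extPts n x (j + 1)) - KBB μ A B n ≤ psum n p j ∧
            psum n p j ≤ cdfE μ A B (extPts n x j) + KBB μ A B n)) ∧
      ((∀ y q : Fin n → ℝ, IsXi A B n y → IsPi n q →
          dKol A B μ (discr n x p) ≤ dKol A B μ (discr n y q)) ↔
        (∀ j : Fin n, psum n p (j : ℕ) < psum n p ((j : ℕ) + 1) →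
          quantm μ A B (psum n p ((j : ℕ) + 1) - KBB μ A B n) ≤ x j ∧
            x j ≤ quant μ A B (psum n p (j : ℕ) + KBB μ A B n)))) := by
  obtain ⟨hK0, hKc, -⟩ := KBB_spec A B μ hn
  obtain ⟨x₀, p₀, hx₀, hp₀, hd₀⟩ := exists_dKol_discr_le hAB hμ hK0 hKc
  refine ⟨⟨x₀, p₀, hx₀, hp₀, fun y q hy hq => hd₀.trans (KBB_le_dKol_discr hn hy hq),
    hd₀.antisymm (KBB_le_dKol_discr hn hx₀ hp₀)⟩, fun x p hx hp => ?_⟩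
  have hbest : (∀ y q : Fin n → ℝ, IsXi A B n y → IsPi n q →
      dKol A B μ (discr n x p) ≤ dKol A B μ (discr n y q)) ↔
      ∀ t, |cdf μ A B t - ∑ j, if x j ≤ t then p j else 0| ≤ KBB μ A B n := by
    rw [← dKol_discr_le_iff hx hp]
    exact ⟨fun h => (h x₀ p₀ hx₀ hp₀).trans hd₀,
      fun h y q hy hq => h.trans (KBB_le_dKol_discr hn hy hq)⟩
  rw [hbest]
  exact ⟨forall_abs_le_iff_weights hx hK0, forall_abs_le_iff_locations hAB hμ hx hp hK0⟩

end BenfordApprox
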